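/- Let A ⊆ 2^ω be a Borel subset of Cantor space with μ(A) < 1/1000, and let (ε_k)_{k<ω} be a sequence of reals in (0,1). Then there exist a tree T ⊆ 2^{<ω} and a strictly increasing sequence of natural numbers (n(k))_{k<ω} such that: lim(T) ∩ A = ∅; μ(lim(T)) = 1/2; for every k and every η ∈ T with |η| ≤ n(k), μ(lim(T) ∩ [η]) is a positive integer multiple of 4^{−(n(k)+1)}; and for every k and every η ∈ T with |η| = n(k), μ(lim(T) ∩ [η]) > 2^{−n(k)} · (1 − ε_k). -/

import Mathlib

open MeasureTheory ENNReal

/-- The basic clopen set `[η]` of all `x ∈ 2^ω` extending the finite binary string `η`. -/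
def cylinder (η : List Bool) : Set (ℕ → Bool) :=
  {x | ∀ i : Fin η.length, x i = η.get i}

/-- `lim(T)`: the set of branches of a tree `T ⊆ 2^{<ω}`, i.e. all `x ∈ 2^ω` whose
finite initial segments all lie in `T`. -/
def limTree (T : Set (List Bool)) : Set (ℕ → Bool) :=
  {x | ∀ n : ℕ, (List.ofFn fun i : Fin n => x i) ∈ T}

open Filter Topology

def res (x : ℕ → Bool) (m : ℕ) : List Bool := List.ofFn fun i : Fin m => x i

lemma res_length (x : ℕ → Bool) (m : ℕ) : (res x m).length = m := by simp [res]

lemma mem_cyl (x : ℕ → Bool) (η : List Bool) : x ∈ cylinder η ↔ res x η.length = η := by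
  unfold _root_.cylinder res
  constructor
  · intro h
    apply List.ext_get
    · simp
    · intro i h1 h2
      simpa using h ⟨i, h2⟩
  · intro h i
    have := List.ofFn_get η
    rw [← this] at h
    have h2 : (List.ofFn fun i : Fin η.length => x i) = List.ofFn η.get := by
      rw [this]; rw [this] at h; exact h
    exact congrFun (List.ofFn_injective h2) i

lemma res_take (x : ℕ → Bool) {n m : ℕ} (h : n ≤ m) : (res x m).take n = res x n := by
  apply List.ext_getElem
  · simp [res, h]
  · intro i h1 h2
    simp [res]

lemma res_prefix (x : ℕ → Bool) {n m : ℕ} (h : n ≤ m) : res x n <+: res x m := by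
  rw [← res_take x h]; exact List.take_prefix _ _

def strs (m : ℕ) : Finset (List Bool) :=
  (Finset.univ : Finset (Fin m → Bool)).image List.ofFn

lemma mem_strs (m : ℕ) (ν : List Bool) : ν ∈ strs m ↔ ν.length = m := by
  simp only [strs, Finset.mem_image, Finset.mem_univ, true_and]
  constructor
  · rintro ⟨a, rfl⟩; simp
  · rintro rfl; exact ⟨ν.get, List.ofFn_get ν⟩

lemma cyl_meas (η : List Bool) : MeasurableSet (cylinder η) := by
  have : cylinder η = ⋂ i : Fin η.length, (fun x : ℕ → Bool => x i) ⁻¹' {η.get i} := by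
    ext x; simp [_root_.cylinder]
  rw [this]
  exact MeasurableSet.iInter fun i => (measurable_pi_apply _) (measurableSet_singleton _)

lemma cyl_disj (m : ℕ) (s : Finset (List Bool)) (hs : s ⊆ strs m) (D : Set (ℕ → Bool)) :
    (s : Set (List Bool)).PairwiseDisjoint (fun ν => D ∩ cylinder ν) := by
  intro a ha b hb hab
  have ha' := (mem_strs m a).1 (hs ha)
  have hb' := (mem_strs m b).1 (hs hb)
  refine Set.disjoint_left.2 ?_
  rintro x ⟨_, hx⟩ ⟨_, hy⟩
  rw [mem_cyl] at hx hy
  apply hab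
  rw [← hx, ← hy, ha', hb']

lemma resSet_eq (m : ℕ) (s : Finset (List Bool)) (hs : s ⊆ strs m) :
    {x | res x m ∈ s} = ⋃ ν ∈ s, (Set.univ ∩ cylinder ν) := by
  ext x
  simp only [Set.mem_ofPred_eq, Set.univ_inter, Set.mem_iUnion, mem_cyl, exists_prop]
  constructor
  · intro h; exact ⟨_, h, by rw [res_length]⟩
  · rintro ⟨ν, h, h2⟩
    rw [(mem_strs m ν).1 (hs h)] at h2
    rwa [h2]

lemma resSet_meas (m : ℕ) (s : Finset (List Bool)) (hs : s ⊆ strs m) :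
    MeasurableSet {x | res x m ∈ s} := by
  rw [resSet_eq m s hs]
  exact Finset.measurableSet_biUnion _ fun b _ => MeasurableSet.univ.inter (cyl_meas b)

lemma resSet_measure (μ : Measure (ℕ → Bool)) [IsProbabilityMeasure μ]
    (hμ : ∀ η : List Bool, μ (cylinder η) = ((2 : ℝ≥0∞) ^ η.length)⁻¹)
    (m : ℕ) (s : Finset (List Bool)) (hs : s ⊆ strs m) :
    μ.real {x | res x m ∈ s} = s.card / 2 ^ m := by
  rw [resSet_eq m s hs, measureReal_biUnion_finset (cyl_disj m s hs _)
    (fun b _ => MeasurableSet.univ.inter (cyl_meas b))]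
  rw [Finset.sum_congr rfl (g := fun _ => ((2 : ℝ) ^ m)⁻¹)]
  · simp [div_eq_mul_inv]
  · intro ν hν
    rw [Set.univ_inter, Measure.real, hμ, (mem_strs m ν).1 (hs hν)]
    simp

lemma sum_cyl (μ : Measure (ℕ → Bool)) [IsProbabilityMeasure μ]
    (m : ℕ) (D : Set (ℕ → Bool)) (hD : MeasurableSet D) :
    μ.real D = ∑ ν ∈ strs m, μ.real (D ∩ cylinder ν) := by
  rw [← measureReal_biUnion_finset (cyl_disj m _ subset_rfl _)
    (fun b _ => hD.inter (cyl_meas b))]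
  congr 1
  ext x
  simp only [Set.mem_iUnion, Set.mem_inter_iff, mem_cyl, exists_prop, mem_strs]
  constructor
  · intro h; exact ⟨res x m, res_length _ _, h, by rw [res_length]⟩
  · rintro ⟨_, _, h, _⟩; exact h

lemma closed_mem (C : Set (ℕ → Bool)) (hC : IsClosed C) (x : ℕ → Bool)
    (h : ∀ m, ∃ n, m ≤ n ∧ (C ∩ cylinder (res x n)).Nonempty) : x ∈ C := by
  choose n hn y hy using h
  refine hC.mem_of_tendsto (f := y) (b := atTop) ?_ (Eventually.of_forall fun m => (hy m).1)
  rw [tendsto_pi_nhds]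
  intro i
  refine tendsto_const_nhds.congr' ?_
  filter_upwards [eventually_gt_atTop i] with m hm
  have h1 := (hy m).2
  rw [mem_cyl, res_length] at h1
  have h2 := congrFun (List.ofFn_injective h1) ⟨i, lt_of_lt_of_le hm (hn m)⟩
  exact h2.symm

lemma distribute {α : Type*} [DecidableEq α] (lo hi : ℕ) (hlh : lo ≤ hi) (s : Finset α) :
    ∀ M : ℕ, s.card * lo ≤ M → M ≤ s.card * hi →
    ∃ f : α → ℕ, (∀ x ∈ s, lo ≤ f x ∧ f x ≤ hi) ∧ (∀ x ∉ s, f x = 0) ∧ ∑ x ∈ s, f x = M := by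
  induction s using Finset.induction_on with
  | empty =>
    intro M h1 h2
    refine ⟨fun _ => 0, by simp, by simp, ?_⟩
    simp at h2 ⊢; exact h2.symm
  | insert a s ha ih =>
    intro M h1 h2
    rw [Finset.card_insert_of_notMem ha, add_mul, one_mul] at h1 h2
    have hc : s.card * lo ≤ s.card * hi := Nat.mul_le_mul_left _ hlh
    obtain ⟨v, hv⟩ : ∃ v, v = max lo (M - s.card * hi) := ⟨_, rfl⟩
    obtain ⟨f, hf1, hf2, hf3⟩ := ih (M - v) (by omega) (by omega)
    refine ⟨Function.update f a v, ?_, ?_, ?_⟩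
    · intro x hx
      by_cases hxa : x = a
      · subst hxa; simp; omega
      · rw [Function.update_of_ne hxa]
        exact hf1 x (Finset.mem_of_mem_insert_of_ne hx hxa)
    · intro x hx
      rw [Finset.mem_insert, not_or] at hx
      rw [Function.update_of_ne hx.1]; exact hf2 x hx.2
    · rw [Finset.sum_insert ha, Function.update_self, Finset.sum_congr rfl (g := f)]
      · rw [hf3]; omega
      · intro x hx
        rw [Function.update_of_ne]; rintro rfl; exact ha hx

lemma density (μ : Measure (ℕ → Bool)) [IsProbabilityMeasure μ]
    (hμ : ∀ η : List Bool, μ (cylinder η) = ((2 : ℝ≥0∞) ^ η.length)⁻¹)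
    (D : Set (ℕ → Bool)) (hD : IsClosed D) (δ : ℝ) (hδ : 0 < δ) (hδ1 : δ < 1)
    (d : ℝ) (hd : d < μ.real D) :
    ∀ᶠ m : ℕ in atTop, ∃ G : Finset (List Bool), G ⊆ strs m ∧
      (∀ ν ∈ G, (1 - δ) / 2 ^ m < μ.real (D ∩ cylinder ν)) ∧ d < G.card / 2 ^ m := by
  classical
  let P : ℕ → Finset (List Bool) := fun m => (strs m).filter fun ν => (D ∩ cylinder ν).Nonempty
  have hP : ∀ m, P m ⊆ strs m := fun m => Finset.filter_subset _ _
  let V : ℕ → Set (ℕ → Bool) := fun m => {x | res x m ∈ P m}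
  have hVmem : ∀ m x, x ∈ V m ↔ (D ∩ cylinder (res x m)).Nonempty := by
    intro m x; simp [V, P, mem_strs, res_length]
  have hanti : Antitone V := by
    intro a b hab x hx
    rw [hVmem] at hx ⊢
    obtain ⟨y, hy, hy2⟩ := hx
    refine ⟨y, hy, ?_⟩
    rw [mem_cyl, res_length] at hy2 ⊢
    rw [← res_take y hab, hy2, res_take x hab]
  have hInter : ⋂ m, V m = D := by
    ext x
    simp only [Set.mem_iInter, hVmem]
    constructor
    · intro h; exact closed_mem D hD x fun m => ⟨m, le_rfl, h m⟩
    · intro h m; exact ⟨x, h, by rw [mem_cyl, res_length]⟩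
  have htend : Tendsto (fun m => μ.real (V m)) atTop (𝓝 (μ.real D)) := by
    have := tendsto_measure_iInter_atTop (μ := μ) (s := V)
      (fun m => (resSet_meas m _ (hP m)).nullMeasurableSet) hanti ⟨0, measure_ne_top _ _⟩
    rw [hInter] at this
    exact (ENNReal.tendsto_toReal (measure_ne_top _ _)).comp this
  have h2 : Tendsto (fun m => (μ.real D - μ.real (V m) * (1 - δ)) / δ) atTop
      (𝓝 ((μ.real D - μ.real D * (1 - δ)) / δ)) :=
    ((tendsto_const_nhds.sub (htend.mul_const _)).div_const _)
  have h3 : (μ.real D - μ.real D * (1 - δ)) / δ = μ.real D := by field_simp; ring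
  rw [h3] at h2
  filter_upwards [h2.eventually_const_lt hd] with m hm
  let G := (P m).filter fun ν => (1 - δ) / 2 ^ m < μ.real (D ∩ cylinder ν)
  refine ⟨G, (Finset.filter_subset _ _).trans (hP m), fun ν hν => (Finset.mem_filter.1 hν).2, ?_⟩
  refine hm.trans_le ?_
  rw [div_le_iff₀ hδ]
  have hV : μ.real (V m) = (P m).card / 2 ^ m := resSet_measure μ hμ m _ (hP m)
  have hsum : μ.real D = ∑ ν ∈ P m, μ.real (D ∩ cylinder ν) := by
    rw [sum_cyl μ m D hD.measurableSet]
    symm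
    apply Finset.sum_subset (hP m)
    intro ν h1 h2
    have : ¬ (D ∩ cylinder ν).Nonempty := fun h => h2 (Finset.mem_filter.2 ⟨h1, h⟩)
    rw [Set.not_nonempty_iff_eq_empty.1 this]; simp
  have hle : μ.real D ≤ ∑ ν ∈ P m, ((1 - δ) / 2 ^ m + if ν ∈ G then δ / 2 ^ m else 0) := by
    rw [hsum]
    apply Finset.sum_le_sum
    intro ν hν
    split_ifs with h
    · rw [← add_div]
      have : μ.real (cylinder ν) = 1 / 2 ^ m := by
        rw [Measure.real, hμ, (mem_strs m ν).1 (hP m hν)]; simp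
      have h5 : μ.real (D ∩ cylinder ν) ≤ μ.real (cylinder ν) :=
        measureReal_mono Set.inter_subset_right
      rw [this] at h5
      rwa [sub_add_cancel]
    · have : ¬ (1 - δ) / 2 ^ m < μ.real (D ∩ cylinder ν) :=
        fun h' => h (Finset.mem_filter.2 ⟨hν, h'⟩)
      linarith
  rw [Finset.sum_add_distrib, ← Finset.sum_filter] at hle
  have hGG : (P m).filter (fun ν => ν ∈ G) = G := by
    ext ν; simp only [Finset.mem_filter]
    exact ⟨fun h => h.2, fun h => ⟨Finset.filter_subset _ _ h, h⟩⟩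
  rw [hGG] at hle
  simp only [Finset.sum_const, nsmul_eq_mul] at hle
  rw [hV]
  have e1 : ((P m).card : ℝ) * ((1 - δ) / 2 ^ m) = (P m).card / 2 ^ m * (1 - δ) := by ring
  have e2 : (G.card : ℝ) * (δ / 2 ^ m) = G.card / 2 ^ m * δ := by ring
  linarith

lemma cyl_closed (η : List Bool) : IsClosed (cylinder η) := by
  have : cylinder η = ⋂ i : Fin η.length, (fun x : ℕ → Bool => x i) ⁻¹' {η.get i} := by
    ext x; simp [_root_.cylinder]
  rw [this]
  exact isClosed_iInter fun i => (isClosed_discrete _).preimage (continuous_apply _)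

lemma numbers (n m e r j g : ℕ) (δ a d : ℝ) (hδe : δ = (1 / 2) ^ (e + 1))
    (hj : 0 < j) (ha : a = j / 4 ^ (n + 1)) (hr : m + 2 = e + 1 + r) (hr2 : 2 * n + 4 ≤ r)
    (hnm : n ≤ m) (hd : (1 / 2 : ℝ) ^ m < d - a / (1 - δ)) (hg : d < g / 2 ^ m) :
    ∃ lo hi M N : ℕ, lo ≤ hi ∧ N * lo ≤ M ∧ M ≤ N * hi ∧ N ≤ g ∧
      (lo : ℝ) = 2 ^ (m + 2) * (1 - 2 * δ) ∧ (hi : ℝ) = 2 ^ (m + 2) * (1 - δ) ∧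
      (M : ℝ) = a * 4 ^ (m + 1) := by
  have h2e : (1 : ℝ) ≤ 2 ^ e := one_le_pow₀ (by norm_num)
  have h2e' : 1 ≤ 2 ^ e := Nat.one_le_two_pow
  have hδe2 : δ * 2 ^ (e + 1) = 1 := by
    rw [hδe, ← mul_pow]; norm_num
  have hδpos : 0 < δ := by rw [hδe]; positivity
  have hδ1 : δ ≤ 1 / 2 := by
    rw [pow_succ] at hδe2; nlinarith
  have hlo : ((2 ^ r * (2 ^ (e + 1) - 2) : ℕ) : ℝ) = 2 ^ (m + 2) * (1 - 2 * δ) := by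
    rw [hr, Nat.cast_mul, Nat.cast_sub (by rw [pow_succ]; omega)]
    push_cast
    rw [pow_add _ (e + 1) r]
    linear_combination (2 * 2 ^ r) * hδe2
  have hhi : ((2 ^ r * (2 ^ (e + 1) - 1) : ℕ) : ℝ) = 2 ^ (m + 2) * (1 - δ) := by
    rw [hr, Nat.cast_mul, Nat.cast_sub (by rw [pow_succ]; omega)]
    push_cast
    rw [pow_add _ (e + 1) r]
    linear_combination (2 ^ r) * hδe2
  have hM : ((j * 4 ^ (m - n) : ℕ) : ℝ) = a * 4 ^ (m + 1) := by
    push_cast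
    rw [ha]
    have : (4 : ℝ) ^ (m + 1) = 4 ^ (m - n) * 4 ^ (n + 1) := by
      rw [← pow_add]; congr 1; omega
    rw [this]; field_simp
  set lo := 2 ^ r * (2 ^ (e + 1) - 2) with hlodef
  set hi := 2 ^ r * (2 ^ (e + 1) - 1) with hhidef
  set M := j * 4 ^ (m - n) with hMdef
  have hp : (0 : ℝ) < 2 ^ (m + 2) := by positivity
  have hhipos : (0 : ℝ) < hi := by rw [hhi]; apply mul_pos hp; linarith
  have hceil := Nat.le_ceil ((M : ℝ) / hi)
  have hceil2 := Nat.ceil_lt_add_one (a := (M : ℝ) / hi) (by positivity)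
  have hlonn : (0 : ℝ) ≤ lo := Nat.cast_nonneg _
  have hdiff : (hi : ℝ) - lo = 2 ^ r := by
    rw [hhi, hlo, hr, pow_add _ (e + 1) r]
    linear_combination (2 ^ r) * hδe2
  refine ⟨lo, hi, M, ⌈(M : ℝ) / hi⌉₊, ?_, ?_, ?_, ?_, hlo, hhi, hM⟩
  · apply Nat.mul_le_mul_left; omega
  · have key : (hi : ℝ) * lo ≤ M * 2 ^ r := by
      have h1 : (hi : ℝ) ≤ 2 ^ (m + 2) := by rw [hhi]; nlinarith
      have h2 : (lo : ℝ) ≤ 2 ^ (m + 2) := by rw [hlo]; nlinarith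
      have h3 : (4 : ℝ) ^ (m - n) ≤ M := by
        rw [hMdef]; push_cast
        have : (1 : ℝ) ≤ j := by exact_mod_cast hj
        have h4 : (0 : ℝ) < 4 ^ (m - n) := by positivity
        nlinarith
      have h4 : (2 : ℝ) ^ (2 * n + 4) ≤ 2 ^ r := pow_le_pow_right₀ (by norm_num) hr2
      calc (hi : ℝ) * lo ≤ 2 ^ (m + 2) * 2 ^ (m + 2) := by gcongr
        _ = 4 ^ (m - n) * 2 ^ (2 * n + 4) := by
          rw [show (4 : ℝ) = 2 ^ 2 by norm_num, ← pow_mul, ← pow_add, ← pow_add]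
          congr 1; omega
        _ ≤ M * 2 ^ r := by gcongr
    have : (⌈(M : ℝ) / hi⌉₊ : ℝ) * lo ≤ M := by
      calc (⌈(M : ℝ) / hi⌉₊ : ℝ) * lo ≤ (M / hi + 1) * lo := by gcongr
        _ = (M * lo + hi * lo) / hi := by field_simp
        _ ≤ M := by
          rw [div_le_iff₀ hhipos]
          have : (hi : ℝ) = lo + 2 ^ r := by linarith
          nlinarith
    exact_mod_cast this
  · rw [div_le_iff₀ hhipos] at hceil
    exact_mod_cast hceil
  · have h1δ : 0 < 1 - δ := by linarith
    have hq : (M : ℝ) / hi = a / (1 - δ) * 2 ^ m := by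
      rw [hM, hhi, show (4 : ℝ) = 2 ^ 2 by norm_num, ← pow_mul]
      rw [div_eq_iff (by positivity)]
      have : (2 : ℝ) ^ (2 * (m + 1)) = 2 ^ m * 2 ^ (m + 2) := by rw [← pow_add]; congr 1; omega
      rw [this]; field_simp
    have hpm : (0 : ℝ) < 2 ^ m := by positivity
    have h5 : d * 2 ^ m < g := by rwa [lt_div_iff₀ hpm] at hg
    have h6 : (1 / 2 : ℝ) ^ m * 2 ^ m = 1 := by rw [← mul_pow]; norm_num
    have : (⌈(M : ℝ) / hi⌉₊ : ℝ) < g := by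
      rw [hq] at hceil2 ⊢
      nlinarith
    exact_mod_cast this.le

lemma localStep (μ : Measure (ℕ → Bool)) [IsProbabilityMeasure μ]
    (hμ : ∀ η : List Bool, μ (cylinder η) = ((2 : ℝ≥0∞) ^ η.length)⁻¹)
    (C : Set (ℕ → Bool)) (hC : IsClosed C) (ε : ℝ) (hε : 0 < ε)
    (η : List Bool) (j : ℕ)
    (haj : j ≠ 0 → (j : ℝ) / 4 ^ (η.length + 1) < μ.real (C ∩ cylinder η)) :
    ∀ᶠ m : ℕ in atTop, ∃ f : List Bool → ℕ,
      (∀ ν, f ν ≠ 0 → ν.length = m ∧ ν.take η.length = η ∧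
        (f ν : ℝ) / 4 ^ (m + 1) < μ.real (C ∩ cylinder ν) ∧
        (1 - ε) / 2 ^ m < (f ν : ℝ) / 4 ^ (m + 1)) ∧
      ∑ ν ∈ strs m, (f ν : ℝ) / 4 ^ (m + 1) = (j : ℝ) / 4 ^ (η.length + 1) := by
  by_cases hj : j = 0
  · exact Eventually.of_forall fun m => ⟨fun _ => 0, by simp, by simp [hj]⟩
  have haj := haj hj
  have hj : 0 < j := Nat.pos_of_ne_zero hj
  obtain ⟨n, hn⟩ : ∃ n, n = η.length := ⟨_, rfl⟩
  rw [← hn] at haj ⊢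
  obtain ⟨a, ha⟩ : ∃ a : ℝ, a = j / 4 ^ (n + 1) := ⟨_, rfl⟩
  rw [← ha] at haj ⊢
  have hapos : 0 < a := by rw [ha]; positivity
  set D := C ∩ cylinder η with hD
  set b := μ.real D with hb
  have hbpos : 0 < b := hapos.trans haj
  have hab : 0 < 1 - a / b := by
    rw [sub_pos, div_lt_one hbpos]; exact haj
  obtain ⟨e, he⟩ := exists_pow_lt_of_lt_one (lt_min hε hab) (by norm_num : (1 / 2 : ℝ) < 1)
  have he1 := he.trans_le (min_le_left _ _)
  have he2 := he.trans_le (min_le_right _ _)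
  obtain ⟨δ, hδ⟩ : ∃ δ : ℝ, δ = (1 / 2) ^ (e + 1) := ⟨_, rfl⟩
  have hδ' : (1 / 2 : ℝ) ^ e = 2 * δ := by rw [hδ, pow_succ]; ring
  rw [hδ'] at he1 he2
  have hδpos : 0 < δ := by rw [hδ]; positivity
  have hab' : 0 < a / b := by positivity
  have hδ1 : δ < 1 := by linarith
  have had : a / (1 - δ) < b := by
    rw [div_lt_iff₀ (by linarith)]
    have : a / b < 1 - δ := by linarith
    rw [div_lt_iff₀ hbpos] at this; linarith
  have hdens := density μ hμ D (hC.inter (cyl_closed η)) δ hδpos hδ1 ((a / (1 - δ) + b) / 2)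
    (by rw [← hb]; linarith)
  have hpow : ∀ᶠ m : ℕ in atTop, (1 / 2 : ℝ) ^ m < (a / (1 - δ) + b) / 2 - a / (1 - δ) :=
    (_root_.tendsto_pow_atTop_nhds_zero_of_lt_one (by norm_num) (by norm_num)).eventually_lt_const
      (by linarith)
  filter_upwards [hdens, hpow, eventually_ge_atTop (e + 1 + (2 * n + 4))] with m hG hpm hm
  obtain ⟨G, hGs, hG1, hG2⟩ := hG
  obtain ⟨lo, hi, M, N, hlh, h1, h2, hNg, hlo, hhi, hM⟩ :=
    numbers n m e (m + 2 - (e + 1)) j G.card δ a _ hδ hj ha (by omega) (by omega) (by omega) hpm hG2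
  obtain ⟨s, hsG, hs⟩ := Finset.exists_subset_card_eq hNg
  obtain ⟨f, hf1, hf2, hf3⟩ := distribute lo hi hlh s M (by rwa [hs]) (by rwa [hs])
  have h4 : (4 : ℝ) ^ (m + 1) = 2 ^ (m + 2) * 2 ^ m := by
    rw [show (4 : ℝ) = 2 ^ 2 by norm_num, ← pow_mul, ← pow_add]; congr 1; omega
  refine ⟨f, ?_, ?_⟩
  · intro ν hν
    have hνs : ν ∈ s := by by_contra h; exact hν (hf2 ν h)
    have hνl := (mem_strs m ν).1 (hGs (hsG hνs))
    have hνG := hG1 ν (hsG hνs)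
    obtain ⟨hfl, hfh⟩ := hf1 ν hνs
    have hfl : (lo : ℝ) ≤ f ν := by exact_mod_cast hfl
    have hfh : (f ν : ℝ) ≤ hi := by exact_mod_cast hfh
    refine ⟨hνl, ?_, ?_, ?_⟩
    · have : (D ∩ cylinder ν).Nonempty := by
        rw [Set.nonempty_iff_ne_empty]
        intro h0
        rw [h0, measureReal_empty] at hνG
        have : 0 < (1 - δ) / 2 ^ m := div_pos (by linarith) (by positivity)
        linarith
      obtain ⟨x, ⟨_, hx1⟩, hx2⟩ := this
      rw [mem_cyl] at hx1 hx2
      rw [← hx2, res_take _ (by omega), hn, hx1]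
    · calc (f ν : ℝ) / 4 ^ (m + 1) ≤ hi / 4 ^ (m + 1) := by gcongr
        _ = (1 - δ) / 2 ^ m := by rw [hhi, h4]; field_simp
        _ < μ.real (D ∩ cylinder ν) := hνG
        _ ≤ _ := measureReal_mono (Set.inter_subset_inter_left _ Set.inter_subset_left)
    · calc (1 - ε) / 2 ^ m < (1 - 2 * δ) / 2 ^ m := by gcongr
        _ = lo / 4 ^ (m + 1) := by rw [hlo, h4]; field_simp
        _ ≤ _ := by gcongr
  · rw [← Finset.sum_div, ← Nat.cast_sum]
    have : ∑ ν ∈ strs m, f ν = M := by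
      rw [← hf3]; symm
      exact Finset.sum_subset (hsG.trans hGs) (fun x _ hx => hf2 x hx)
    rw [this, hM]; field_simp

def GoodSt (μ : Measure (ℕ → Bool)) (C : Set (ℕ → Bool)) (p : ℕ × (List Bool → ℕ)) : Prop :=
  ∀ η, p.2 η ≠ 0 → η.length = p.1 ∧ (p.2 η : ℝ) / 4 ^ (p.1 + 1) < μ.real (C ∩ cylinder η)

def StepSt (ε : ℝ) (p q : ℕ × (List Bool → ℕ)) : Prop :=
  p.1 < q.1 ∧ (∀ η, q.2 η ≠ 0 → (1 - ε) / 2 ^ q.1 < (q.2 η : ℝ) / 4 ^ (q.1 + 1)) ∧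
  ∀ η ∈ strs p.1, ∑ ν ∈ strs q.1 with ν.take p.1 = η, (q.2 ν : ℝ) / 4 ^ (q.1 + 1) =
    (p.2 η : ℝ) / 4 ^ (p.1 + 1)

lemma globalStep (μ : Measure (ℕ → Bool)) [IsProbabilityMeasure μ]
    (hμ : ∀ η : List Bool, μ (cylinder η) = ((2 : ℝ≥0∞) ^ η.length)⁻¹)
    (C : Set (ℕ → Bool)) (hC : IsClosed C) (ε : ℝ) (hε : 0 < ε)
    (p : ℕ × (List Bool → ℕ)) (hp : GoodSt μ C p) : ∃ q, GoodSt μ C q ∧ StepSt ε p q := by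
  obtain ⟨n, w⟩ := p
  have h1 : ∀ η ∈ strs n, _ := fun η hη =>
    localStep μ hμ C hC ε hε η (w η) (fun h => by
      have := hp η h
      rw [this.1]; exact this.2)
  rw [← Filter.eventually_all_finset] at h1
  obtain ⟨m, hm, hnm⟩ := (h1.and (eventually_gt_atTop n)).exists
  choose! f hf using hm
  refine ⟨⟨m, fun ν => if ν.length = m then f (ν.take n) ν else 0⟩, ?_, hnm, ?_, ?_⟩
  · intro ν hν
    simp only [ne_eq, ite_eq_right_iff, Classical.not_imp] at hν
    have hmem : ν.take n ∈ strs n := by rw [mem_strs, List.length_take]; omega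
    have := (hf _ hmem).1 ν hν.2
    simp only [hν.1, if_true]
    exact ⟨trivial, this.2.2.1⟩
  · intro ν hν
    simp only [ne_eq, ite_eq_right_iff, Classical.not_imp] at hν
    have hmem : ν.take n ∈ strs n := by rw [mem_strs, List.length_take]; omega
    have := (hf _ hmem).1 ν hν.2
    simp only [hν.1, if_true]
    exact this.2.2.2
  · intro η hη
    have hl := (mem_strs _ _).1 hη
    simp only at hl hη ⊢
    have h2 := (hf η hη).2
    rw [hl] at h2
    rw [← h2, Finset.sum_filter]
    apply Finset.sum_congr rfl
    intro ν hν
    rw [if_pos ((mem_strs _ _).1 hν)]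
    split_ifs with h
    · rw [h]
    · by_cases h0 : f η ν = 0
      · simp [h0]
      · have := ((hf η hη).1 ν h0).2.1
        rw [hl] at this; exact absurd this h

noncomputable def massSt (p : ℕ × (List Bool → ℕ)) (s : List Bool) : ℝ :=
  ∑ ν ∈ strs p.1 with ν.take s.length = s, (p.2 ν : ℝ) / 4 ^ (p.1 + 1)

lemma mass_step (ε : ℝ) (p q : ℕ × (List Bool → ℕ)) (h : StepSt ε p q) (s : List Bool)
    (hs : s.length ≤ p.1) : massSt q s = massSt p s := by
  obtain ⟨hlt, -, hsum⟩ := h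
  unfold massSt
  have hmaps : ∀ ν ∈ (strs q.1).filter (fun ν => ν.take s.length = s),
      ν.take p.1 ∈ (strs p.1).filter (fun ν => ν.take s.length = s) := by
    intro ν hν
    rw [Finset.mem_filter, mem_strs] at hν ⊢
    refine ⟨by rw [List.length_take]; omega, ?_⟩
    rw [List.take_take, min_eq_left hs]; exact hν.2
  rw [← Finset.sum_fiberwise_of_maps_to hmaps]
  apply Finset.sum_congr rfl
  intro η hη
  rw [Finset.mem_filter] at hη
  rw [← hsum η hη.1, Finset.filter_filter]
  apply Finset.sum_congr _ (fun _ _ => rfl)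
  ext ν
  simp only [Finset.mem_filter]
  constructor
  · rintro ⟨a, b, c⟩; exact ⟨a, c⟩
  · rintro ⟨a, b⟩
    refine ⟨a, ?_, b⟩
    have h := hη.2
    rwa [← b, List.take_take, min_eq_left hs] at h

lemma mass_pos (μ : Measure (ℕ → Bool)) (C : Set (ℕ → Bool)) (p : ℕ × (List Bool → ℕ))
    (hp : GoodSt μ C p) (s : List Bool) :
    0 < massSt p s ↔ ∃ ν, p.2 ν ≠ 0 ∧ s <+: ν := by
  unfold massSt
  constructor
  · intro h
    obtain ⟨ν, hν, h2⟩ := Finset.exists_ne_zero_of_sum_ne_zero h.ne'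
    rw [Finset.mem_filter] at hν
    refine ⟨ν, ?_, ?_⟩
    · intro h0; simp [h0] at h2
    · rw [List.prefix_iff_eq_take]; exact hν.2.symm
  · rintro ⟨ν, h1, h2⟩
    refine Finset.sum_pos' (fun _ _ => by positivity) ⟨ν, ?_, ?_⟩
    · rw [Finset.mem_filter, mem_strs]
      exact ⟨(hp ν h1).1, (List.prefix_iff_eq_take.1 h2).symm⟩
    · have : 0 < p.2 ν := Nat.pos_of_ne_zero h1
      positivity

lemma mass_full (p : ℕ × (List Bool → ℕ)) (s : List Bool) (hs : s.length = p.1) :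
    massSt p s = (p.2 s : ℝ) / 4 ^ (p.1 + 1) := by
  unfold massSt
  have : (strs p.1).filter (fun ν => ν.take s.length = s) = {s} := by
    ext ν
    simp only [Finset.mem_filter, mem_strs, Finset.mem_singleton]
    constructor
    · rintro ⟨a, b⟩; rw [hs, ← a, List.take_length] at b; exact b
    · rintro rfl; exact ⟨hs, List.take_length⟩
  rw [this, Finset.sum_singleton]

/-- Let `μ` be the fair-coin product measure on Cantor space (characterized by its
values `2^{-|η|}` on the basic clopen sets `[η]`), let `A` be Borel with
`μ(A) < 1/1000` and let `(ε_k)` be a sequence in `(0,1)`. Then there are a tree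
`T ⊆ 2^{<ω}` and a strictly increasing sequence `(n(k))` such that `lim(T) ∩ A = ∅`,
`μ(lim(T)) = 1/2`, for every `k` and `η ∈ T` with `|η| ≤ n(k)` the measure
`μ(lim(T) ∩ [η])` is a positive integer multiple of `4^{-(n(k)+1)}`, and for every
`k` and `η ∈ T` with `|η| = n(k)` one has `μ(lim(T) ∩ [η]) > 2^{-n(k)} (1 - ε_k)`. -/
theorem stmt5 (μ : Measure (ℕ → Bool)) [IsProbabilityMeasure μ]
    (hμ : ∀ η : List Bool, μ (cylinder η) = ((2 : ℝ≥0∞) ^ η.length)⁻¹)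
    (A : Set (ℕ → Bool)) (hA : MeasurableSet A) (hAsmall : μ A < 1 / 1000)
    (ε : ℕ → ℝ) (hε : ∀ k, ε k ∈ Set.Ioo (0 : ℝ) 1) :
    ∃ (T : Set (List Bool)) (n : ℕ → ℕ),
      (∀ s ∈ T, ∀ t : List Bool, t <+: s → t ∈ T) ∧
      StrictMono n ∧
      limTree T ∩ A = ∅ ∧
      μ (limTree T) = 1 / 2 ∧
      (∀ k : ℕ, ∀ η ∈ T, η.length ≤ n k → ∃ j : ℕ, 1 ≤ j ∧
        μ (limTree T ∩ cylinder η) = j * ((4 : ℝ≥0∞) ^ (n k + 1))⁻¹) ∧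
      (∀ k : ℕ, ∀ η ∈ T, η.length = n k →
        ((2 : ℝ≥0∞) ^ n k)⁻¹ * ENNReal.ofReal (1 - ε k) < μ (limTree T ∩ cylinder η)) := by
  classical
  -- a closed set avoiding `A`
  obtain ⟨C, hCA, hC, hCm⟩ : ∃ C, C ⊆ Aᶜ ∧ IsClosed C ∧ 1 / 2 < μ C := by
    apply hA.compl.exists_lt_isClosed_of_ne_top (measure_ne_top _ _)
    rw [prob_compl_eq_one_sub hA]
    have h1 : (1 : ℝ≥0∞) / 1000 ≤ 1 / 2 := by
      apply ENNReal.div_le_div_left; norm_num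
    have h2 : (1 : ℝ≥0∞) / 2 < 1 - μ A := by
      rw [lt_tsub_iff_right]
      calc 1 / 2 + μ A < 1 / 2 + 1 / 2 :=
            ENNReal.add_lt_add_left (by simp) (hAsmall.trans_le h1)
        _ = 1 := ENNReal.add_halves 1
    exact h2
  have hCr : 1 / 2 < μ.real C := by
    have := (ENNReal.toReal_lt_toReal (by simp) (measure_ne_top _ _)).2 hCm
    simpa [Measure.real] using this
  let ε' : ℕ → ℝ := fun k => min (ε k) (1 / ((k : ℝ) + 1 + 1))
  have hε' : ∀ k, 0 < ε' k := fun k => lt_min (hε k).1 (by positivity)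
  have hstep : ∀ (k : ℕ) (p : {p // GoodSt μ C p}), ∃ q : {p // GoodSt μ C p},
      StepSt (ε' k) p.1 q.1 := by
    rintro k ⟨p, hp⟩
    obtain ⟨q, hq, h⟩ := globalStep μ hμ C hC (ε' k) (hε' k) p hp
    exact ⟨⟨q, hq⟩, h⟩
  choose nxt hnxt using hstep
  have hgood0 : GoodSt μ C (0, fun η => if η = [] then 2 else 0) := by
    intro η hη
    simp only [ne_eq, ite_eq_right_iff, Classical.not_imp] at hη
    obtain ⟨rfl, -⟩ := hη
    have : cylinder [] = Set.univ := by ext x; simp [_root_.cylinder]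
    rw [this, Set.inter_univ]
    refine ⟨rfl, ?_⟩
    simp only [if_true]
    norm_num; linarith
  let P : ℕ → {p // GoodSt μ C p} := fun k => Nat.rec ⟨_, hgood0⟩ (fun k p => nxt k p) k
  have hP0 : (P 0).1 = (0, fun η => if η = [] then 2 else 0) := rfl
  have hPs : ∀ k, StepSt (ε' k) (P k).1 (P (k + 1)).1 := fun k => hnxt k (P k)
  have hPg : ∀ k, GoodSt μ C (P k).1 := fun k => (P k).2
  generalize hQ : (fun k => (P k).1) = Q at *
  have hQk : ∀ k, (P k).1 = Q k := fun k => congrFun hQ k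
  simp only [hQk] at hP0 hPs hPg
  clear hQk hQ
  clear P
  let N : ℕ → ℕ := fun k => (Q k).1
  let w : ℕ → List Bool → ℕ := fun k => (Q k).2
  have hN : StrictMono N := strictMono_nat_of_lt_succ fun k => (hPs k).1
  have hmass : ∀ s k, s.length ≤ N k → ∀ l, k ≤ l → massSt (Q l) s = massSt (Q k) s := by
    intro s k hs l hl
    induction l, hl using Nat.le_induction with
    | base => rfl
    | succ l hl ih =>
      rw [← ih]; exact mass_step _ _ _ (hPs l) s (hs.trans (hN.monotone hl))
  let T : Set (List Bool) := {s | ∃ k ν, w k ν ≠ 0 ∧ s <+: ν}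
  have hTmass : ∀ s k, s.length ≤ N k → (s ∈ T ↔ 0 < massSt (Q k) s) := by
    intro s k hs
    constructor
    · rintro ⟨l, ν, h1, h2⟩
      have hp : 0 < massSt (Q l) s := (mass_pos μ C _ (hPg l) s).2 ⟨ν, h1, h2⟩
      have hsl : s.length ≤ N l := by
        have : ν.length = N l := (hPg l ν h1).1
        have h3 := h2.length_le
        omega
      rcases le_total k l with h | h
      · rwa [hmass s k hs l h] at hp
      · rwa [hmass s l hsl k h]
    · intro h
      obtain ⟨ν, h1, h2⟩ := (mass_pos μ C _ (hPg k) s).1 h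
      exact ⟨k, ν, h1, h2⟩
  have hTfull : ∀ s k, s.length = N k → (s ∈ T ↔ w k s ≠ 0) := by
    intro s k hs
    constructor
    · intro h
      rw [hTmass s k hs.le, mass_full _ _ hs] at h
      intro h0
      have h0 : (Q k).2 s = 0 := h0
      rw [h0] at h; simp at h
    · intro h; exact ⟨k, s, h, List.prefix_rfl⟩
  have hTpre : ∀ s ∈ T, ∀ t : List Bool, t <+: s → t ∈ T := by
    rintro s ⟨k, ν, h1, h2⟩ t ht
    exact ⟨k, ν, h1, ht.trans h2⟩
  have hlim : ∀ x, x ∈ limTree T ↔ ∀ k, w k (res x (N k)) ≠ 0 := by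
    intro x
    constructor
    · intro h k
      exact (hTfull _ k (res_length _ _)).1 (h (N k))
    · intro h m
      exact ⟨m, res x (N m), h m, res_prefix x (hN.id_le m)⟩
  have hlimC : limTree T ⊆ C := by
    intro x hx
    rw [hlim] at hx
    apply closed_mem C hC
    intro m
    refine ⟨N m, hN.id_le m, ?_⟩
    rw [Set.nonempty_iff_ne_empty]
    intro h0
    have := (hPg m _ (hx m)).2
    rw [h0, measureReal_empty] at this
    have h3 : (0 : ℝ) ≤ ((Q m).2 (res x (N m)) : ℝ) / 4 ^ ((Q m).1 + 1) := by positivity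
    linarith
  -- the measure of the branches through `s`
  have hmeas : ∀ s k, s.length ≤ N k → μ.real (limTree T ∩ cylinder s) = massSt (Q k) s := by
    intro s k hs
    let R : ℕ → Finset (List Bool) := fun l =>
      (strs (N l)).filter fun ν => ν.take s.length = s ∧ w l ν ≠ 0
    have hR : ∀ l, R l ⊆ strs (N l) := fun l => Finset.filter_subset _ _
    let V : ℕ → Set (ℕ → Bool) := fun i => {x | res x (N (k + 1 + i)) ∈ R (k + 1 + i)}
    have hVmem : ∀ i x, x ∈ V i ↔ x ∈ cylinder s ∧ res x (N (k + 1 + i)) ∈ T := by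
      intro i x
      have hle : s.length ≤ N (k + 1 + i) := hs.trans (hN.monotone (by omega))
      rw [hTfull _ (k + 1 + i) (res_length _ _), mem_cyl]
      simp only [V, R, Set.mem_ofPred_eq, Finset.mem_filter, mem_strs, res_length, true_and,
        res_take x hle]
    have hanti : Antitone V := by
      intro a b hab x hx
      rw [hVmem] at hx ⊢
      exact ⟨hx.1, hTpre _ hx.2 _ (res_prefix x (hN.monotone (by omega)))⟩
    have hInter : ⋂ i, V i = limTree T ∩ cylinder s := by
      ext x
      simp only [Set.mem_iInter, hVmem, Set.mem_inter_iff]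
      constructor
      · intro h
        refine ⟨fun m => ?_, (h 0).1⟩
        refine hTpre _ (h m).2 _ (res_prefix x ?_)
        have := hN.id_le (k + 1 + m)
        simp only [id] at this
        omega
      · rintro ⟨h1, h2⟩ i; exact ⟨h2, h1 _⟩
    have htend : Tendsto (fun m => μ.real (V m)) atTop (𝓝 (μ.real (limTree T ∩ cylinder s))) := by
      have := tendsto_measure_iInter_atTop (μ := μ) (s := V)
        (fun m => (resSet_meas _ _ (hR _)).nullMeasurableSet) hanti ⟨0, measure_ne_top _ _⟩
      rw [hInter] at this
      exact (ENNReal.tendsto_toReal (measure_ne_top _ _)).comp this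
    have hV : ∀ i, μ.real (V i) = (R (k + 1 + i)).card / 2 ^ N (k + 1 + i) := fun i =>
      resSet_measure μ hμ _ _ (hR _)
    have hmR : ∀ i, massSt (Q k) s =
        ∑ ν ∈ R (k + 1 + i), (w (k + 1 + i) ν : ℝ) / 4 ^ (N (k + 1 + i) + 1) := by
      intro i
      rw [← hmass s k hs (k + 1 + i) (by omega)]
      unfold massSt
      symm
      apply Finset.sum_subset
      · intro ν hν
        rw [Finset.mem_filter] at hν ⊢
        exact ⟨hν.1, hν.2.1⟩
      · intro ν h1 h2
        rw [Finset.mem_filter] at h1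
        have : w (k + 1 + i) ν = 0 := by
          by_contra h0; exact h2 (Finset.mem_filter.2 ⟨h1.1, h1.2, h0⟩)
        rw [this]; simp
    have hub : ∀ i, massSt (Q k) s ≤ μ.real (V i) := by
      intro i
      rw [hmR i, hV i, div_eq_mul_inv, ← nsmul_eq_mul]
      apply Finset.sum_le_card_nsmul
      intro ν hν
      have h1 := (Finset.mem_filter.1 hν)
      have h2 := (hPg _ ν h1.2.2).2
      refine h2.le.trans ((measureReal_mono Set.inter_subset_right).trans ?_)
      rw [Measure.real, hμ, (mem_strs _ _).1 h1.1]; simp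
    have hlb : ∀ i : ℕ, μ.real (V i) * (1 - 1 / ((i : ℝ) + 1)) ≤ massSt (Q k) s := by
      intro i
      rw [hmR i, hV i, div_mul_eq_mul_div, mul_div_assoc, ← nsmul_eq_mul]
      apply Finset.card_nsmul_le_sum
      intro ν hν
      have h1 := (Finset.mem_filter.1 hν)
      have hst := hPs (k + i)
      rw [show k + i + 1 = k + 1 + i by omega] at hst
      have h2 := (hst.2.1 ν h1.2.2).le
      refine le_trans ?_ h2
      have h3 : ε' (k + i) ≤ 1 / ((i : ℝ) + 1) := by
        refine (min_le_right _ _).trans ?_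
        apply one_div_le_one_div_of_le (by positivity)
        push_cast
        have : (0 : ℝ) ≤ k := Nat.cast_nonneg _
        linarith
      show (1 - 1 / ((i : ℝ) + 1)) / 2 ^ (Q (k + 1 + i)).1 ≤ _
      gcongr
    have ht2 : Tendsto (fun i : ℕ => μ.real (V i) * (1 - 1 / ((i : ℝ) + 1))) atTop
        (𝓝 (μ.real (limTree T ∩ cylinder s) * (1 - 0))) :=
      htend.mul (tendsto_const_nhds.sub tendsto_one_div_add_atTop_nhds_zero_nat)
    rw [sub_zero, mul_one] at ht2
    exact le_antisymm (le_of_tendsto' ht2 hlb) (ge_of_tendsto' htend hub)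
  have hmeas' : ∀ s k, s.length ≤ N k →
      μ (limTree T ∩ cylinder s) = ENNReal.ofReal (massSt (Q k) s) := by
    intro s k hs
    rw [← hmeas s k hs, Measure.real, ENNReal.ofReal_toReal (measure_ne_top _ _)]
  refine ⟨T, fun k => N (k + 1), hTpre, fun a b h => hN (by omega), ?_, ?_, ?_, ?_⟩
  · ext x
    simp only [Set.mem_inter_iff, Set.mem_empty_iff_false, iff_false, not_and]
    intro h1 h2
    exact hCA (hlimC h1) h2
  · have h1 := hmeas' [] 0 (by simp)
    have : cylinder [] = Set.univ := by ext x; simp [_root_.cylinder]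
    rw [this, Set.inter_univ, mass_full _ _ (by rw [hP0]; rfl), hP0] at h1
    rw [h1]
    simp only [if_true]
    rw [show (((2 : ℕ) : ℝ) / 4 ^ (0 + 1)) = 1 / 2 by norm_num,
      ENNReal.ofReal_div_of_pos (by norm_num)]
    simp
  · intro k η hη hl
    have hpos := (hTmass η (k + 1) hl).1 hη
    have hm : massSt (Q (k + 1)) η =
        ((∑ ν ∈ strs (N (k + 1)) with ν.take η.length = η, w (k + 1) ν : ℕ) : ℝ)
          / 4 ^ (N (k + 1) + 1) := by
      unfold massSt
      rw [Nat.cast_sum, Finset.sum_div]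
    refine ⟨∑ ν ∈ strs (N (k + 1)) with ν.take η.length = η, w (k + 1) ν, ?_, ?_⟩
    · rw [Nat.one_le_iff_ne_zero]
      intro h0
      rw [hm, h0] at hpos
      simp at hpos
    · rw [hmeas' η (k + 1) hl, hm, ENNReal.ofReal_div_of_pos (by positivity),
        ENNReal.ofReal_natCast, ENNReal.ofReal_pow (by norm_num), div_eq_mul_inv]
      norm_num
  · intro k η hη hl
    have hw := (hTfull η (k + 1) hl).1 hη
    have h1 := (hPs k).2.1 η hw
    rw [hmeas' η (k + 1) hl.le, mass_full _ _ hl]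
    have h2 : (1 - ε k) / 2 ^ N (k + 1) < ((Q (k + 1)).2 η : ℝ) / 4 ^ ((Q (k + 1)).1 + 1) := by
      refine lt_of_le_of_lt ?_ h1
      have : ε' k ≤ ε k := min_le_left _ _
      show (1 - ε k) / 2 ^ (Q (k + 1)).1 ≤ _
      gcongr
    have h3 : ((2 : ℝ≥0∞) ^ N (k + 1))⁻¹ * ENNReal.ofReal (1 - ε k) =
        ENNReal.ofReal ((1 - ε k) / 2 ^ N (k + 1)) := by
      rw [ENNReal.ofReal_div_of_pos (by positivity), ENNReal.ofReal_pow (by norm_num),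
        div_eq_mul_inv, mul_comm]
      norm_num
    show ((2 : ℝ≥0∞) ^ N (k + 1))⁻¹ * ENNReal.ofReal (1 - ε k) < _
    rw [h3]
    have hnn : 0 ≤ (1 - ε k) / 2 ^ N (k + 1) := div_nonneg (by linarith [(hε k).2]) (by positivity)
    exact (ENNReal.ofReal_lt_ofReal_iff_of_nonneg hnn).2 h2
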